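/- Let n be an odd positive integer and let u be a classical solution of (CH_n) on [0,T). Suppose there exists a nonempty open rectangle R = (t₀,t₁) × (x₀,x₁) ⊂ [0,T) × ℝ (with 0 ≤ t₀ < t₁ ≤ T and x₀ < x₁) such that u(t,x) = 0 for all (t,x) ∈ R. Then u(t,x) = 0 for all (t,x) ∈ [0,T) × ℝ. -/

import Mathlib

open Real MeasureTheory Filter Topology
open scoped ENNReal

/-- The Green function `g(x) = e^{-|x|}/2` of `1 - ∂ₓ²` on `ℝ`. -/
noncomputable def g (x : ℝ) : ℝ := Real.exp (-|x|) / 2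

/-- `u_x`. -/
noncomputable def ux (u : ℝ → ℝ → ℝ) (t x : ℝ) : ℝ := deriv (u t) x
/-- `u_{xx}`. -/
noncomputable def uxx (u : ℝ → ℝ → ℝ) (t x : ℝ) : ℝ := deriv (deriv (u t)) x
/-- `u_{xxx}`. -/
noncomputable def uxxx (u : ℝ → ℝ → ℝ) (t x : ℝ) : ℝ := deriv (deriv (deriv (u t))) x
/-- `u_t`. -/
noncomputable def ut (u : ℝ → ℝ → ℝ) (t x : ℝ) : ℝ := deriv (fun s => u s x) t
/-- `u_{tx}`. -/
noncomputable def utx (u : ℝ → ℝ → ℝ) (t x : ℝ) : ℝ := deriv (fun s => ux u s x) t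
/-- `u_{txx}`. -/
noncomputable def utxx (u : ℝ → ℝ → ℝ) (t x : ℝ) : ℝ := deriv (fun s => uxx u s x) t

/-- `f_t(x) = (n/2) u^{n-1} u_x² + (n(n+3)/(2(n+1))) u^{n+1}`. -/
noncomputable def fLoc (n : ℕ) (u : ℝ → ℝ → ℝ) (t x : ℝ) : ℝ :=
  ((n : ℝ) / 2) * u t x ^ (n - 1) * ux u t x ^ 2
    + ((n : ℝ) * ((n : ℝ) + 3) / (2 * ((n : ℝ) + 1))) * u t x ^ (n + 1)

/-- `F_t(x) = ∂ₓ (g ∗ f_t)(x)`. -/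
noncomputable def FLoc (n : ℕ) (u : ℝ → ℝ → ℝ) (t x : ℝ) : ℝ :=
  deriv (fun z => ∫ y : ℝ, g (z - y) * fLoc n u t y) x

/-- The equation (CH_n) holds pointwise at `(t,x)`. -/
def CHn (n : ℕ) (u : ℝ → ℝ → ℝ) (t x : ℝ) : Prop :=
  ut u t x - utxx u t x
      + (((n : ℝ) + 1) * ((n : ℝ) + 2) / 2) * u t x ^ n * ux u t x
    = ((n : ℝ) * ((n : ℝ) - 1) / 2) * u t x ^ (n - 2) * ux u t x ^ 3
      + 2 * (n : ℝ) * u t x ^ (n - 1) * ux u t x * uxx u t x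
      + u t x ^ n * uxxx u t x

/-- The time interval `[0, T)`, where `T ∈ (0, ∞]`. -/
def timeDomain (T : ℝ≥0∞) : Set ℝ := {t : ℝ | 0 ≤ t ∧ ENNReal.ofReal t < T}

/-- A function which is bounded, integrable, square-integrable and tends to `0` at `±∞`. -/
def Decays (w : ℝ → ℝ) : Prop :=
  (∃ C : ℝ, ∀ x : ℝ, |w x| ≤ C) ∧ Integrable w ∧
    Integrable (fun x => w x ^ 2) ∧ Tendsto w (cocompact ℝ) (𝓝 0)

/-- A classical solution of (CH_n) on `[0,T) × ℝ`. -/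
structure IsClassicalSolution (n : ℕ) (T : ℝ≥0∞) (u : ℝ → ℝ → ℝ) : Prop where
  contDiff_x : ∀ t ∈ timeDomain T, ContDiff ℝ 3 (u t)
  diff_t : ∀ x : ℝ, ∀ t ∈ timeDomain T, DifferentiableAt ℝ (fun s => u s x) t
  diff_tx : ∀ x : ℝ, ∀ t ∈ timeDomain T, DifferentiableAt ℝ (fun s => ux u s x) t
  diff_txx : ∀ x : ℝ, ∀ t ∈ timeDomain T, DifferentiableAt ℝ (fun s => uxx u s x) t
  cont_ut : ContinuousOn (fun p : ℝ × ℝ => ut u p.1 p.2) (timeDomain T ×ˢ Set.univ)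
  cont_utx : ContinuousOn (fun p : ℝ × ℝ => utx u p.1 p.2) (timeDomain T ×ˢ Set.univ)
  cont_utxx : ContinuousOn (fun p : ℝ × ℝ => utxx u p.1 p.2) (timeDomain T ×ˢ Set.univ)
  pde : ∀ t ∈ timeDomain T, ∀ x : ℝ, CHn n u t x
  nonlocal : ∀ t ∈ timeDomain T, ∀ x : ℝ,
    ut u t x + u t x ^ n * ux u t x + FLoc n u t x = 0
  decay_u : ∀ t ∈ timeDomain T, Decays (u t)
  decay_ux : ∀ t ∈ timeDomain T, Decays (ux u t)
  decay_uxx : ∀ t ∈ timeDomain T, Decays (uxx u t)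
  decay_ut : ∀ t ∈ timeDomain T, Decays (ut u t)
  sup_bound : ∀ T₀ ∈ timeDomain T, ∃ M : ℝ, ∀ t ∈ Set.Icc (0 : ℝ) T₀, ∀ x : ℝ,
    |u t x| + |ux u t x| ≤ M

lemma integrableOn_exp_mul_bdd_Iic (f : ℝ → ℝ) (hf : Continuous f) (C : ℝ) (hC : ∀ y, |f y| ≤ C) (z : ℝ) :
    IntegrableOn (fun y => exp y * f y) (Set.Iic z) := by
  refine Integrable.mul_bdd (c := C) (integrableOn_exp_Iic z) hf.aestronglyMeasurable ?_
  exact Eventually.of_forall fun y => hC y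

lemma integrableOn_exp_mul_bdd_Ioi (f : ℝ → ℝ) (hf : Continuous f) (C : ℝ) (hC : ∀ y, |f y| ≤ C) (z : ℝ) :
    IntegrableOn (fun y => exp (-y) * f y) (Set.Ioi z) := by
  refine Integrable.mul_bdd (c := C) (integrableOn_exp_neg_Ioi z) hf.aestronglyMeasurable ?_
  exact Eventually.of_forall fun y => hC y

lemma green_props (f : ℝ → ℝ) (hf : Continuous f) (C : ℝ) (hC : ∀ y, |f y| ≤ C) :
    ∃ H : ℝ → ℝ, (∀ z, Integrable (fun y => g (z - y) * f y)) ∧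
      (∀ z, HasDerivAt (fun z => ∫ y : ℝ, g (z - y) * f y) (H z) z) ∧
      (∀ z, HasDerivAt H ((∫ y : ℝ, g (z - y) * f y) - f z) z) ∧
      (∀ z, |H z| ≤ C) ∧ (∀ z, |∫ y : ℝ, g (z - y) * f y| ≤ C) := by
  set P : ℝ → ℝ := fun z => ∫ y in Set.Iic z, exp y * f y with hP
  set Q : ℝ → ℝ := fun z => ∫ y in Set.Ioi z, exp (-y) * f y with hQ
  have iP := integrableOn_exp_mul_bdd_Iic f hf C hC
  have iQ := integrableOn_exp_mul_bdd_Ioi f hf C hC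
  have dP : ∀ z, HasDerivAt P (exp z * f z) z := by
    intro z
    have h1 : ∀ w, P w = P 0 + ∫ y in (0:ℝ)..w, exp y * f y := by
      intro w
      rw [← intervalIntegral.integral_Iic_sub_Iic (iP 0) (iP w)]; ring
    have h2 : HasDerivAt (fun w => P 0 + ∫ y in (0:ℝ)..w, exp y * f y) (exp z * f z) z := by
      apply HasDerivAt.const_add
      have hc : Continuous (fun y => exp y * f y) := by fun_prop
      exact hc.integral_hasStrictDerivAt 0 z |>.hasDerivAt
    exact h2.congr_of_eventuallyEq (Eventually.of_forall h1)
  have dQ : ∀ z, HasDerivAt Q (-(exp (-z) * f z)) z := by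
    intro z
    have h1 : ∀ w, Q w = Q 0 - ∫ y in (0:ℝ)..w, exp (-y) * f y := by
      intro w
      rw [← intervalIntegral.integral_Ioi_sub_Ioi' (iQ 0) (iQ w)]; ring
    have h2 : HasDerivAt (fun w => Q 0 - ∫ y in (0:ℝ)..w, exp (-y) * f y) (-(exp (-z) * f z)) z := by
      apply HasDerivAt.const_sub
      have hc : Continuous (fun y => exp (-y) * f y) := by fun_prop
      exact hc.integral_hasStrictDerivAt 0 z |>.hasDerivAt
    exact h2.congr_of_eventuallyEq (Eventually.of_forall h1)
  have bP : ∀ z, |P z| ≤ C * exp z := by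
    intro z
    have : |P z| ≤ ∫ y in Set.Iic z, C * exp y := by
      rw [hP, ← Real.norm_eq_abs]
      refine norm_integral_le_of_norm_le (Integrable.const_mul (integrableOn_exp_Iic z) C) ?_
      refine Eventually.of_forall fun y => ?_
      rw [norm_mul, mul_comm, Real.norm_eq_abs, Real.norm_eq_abs, abs_of_pos (exp_pos y)]
      exact mul_le_mul_of_nonneg_right (hC y) (exp_pos y).le
    rwa [integral_const_mul, integral_exp_Iic] at this
  have bQ : ∀ z, |Q z| ≤ C * exp (-z) := by
    intro z
    have : |Q z| ≤ ∫ y in Set.Ioi z, C * exp (-y) := by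
      rw [hQ, ← Real.norm_eq_abs]
      refine norm_integral_le_of_norm_le (Integrable.const_mul (integrableOn_exp_neg_Ioi z) C) ?_
      refine Eventually.of_forall fun y => ?_
      rw [norm_mul, mul_comm, Real.norm_eq_abs, Real.norm_eq_abs, abs_of_pos (exp_pos _)]
      exact mul_le_mul_of_nonneg_right (hC y) (exp_pos _).le
    rwa [integral_const_mul, integral_exp_neg_Ioi] at this
  have e1 : ∀ z, Set.EqOn (fun y => exp (-z) / 2 * (exp y * f y)) (fun y => g (z - y) * f y) (Set.Iic z) := by
    intro z y hy
    have hy : y ≤ z := hy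
    simp only [g]
    rw [abs_of_nonneg (by linarith), neg_sub, sub_eq_neg_add, exp_add]; ring
  have e2 : ∀ z, Set.EqOn (fun y => exp z / 2 * (exp (-y) * f y)) (fun y => g (z - y) * f y) (Set.Ioi z) := by
    intro z y hy
    have hy : z < y := hy
    simp only [g]
    rw [abs_of_neg (by linarith), neg_neg, sub_eq_add_neg, exp_add]; ring
  have j1 : ∀ z, IntegrableOn (fun y => g (z - y) * f y) (Set.Iic z) := fun z =>
    IntegrableOn.congr_fun (Integrable.const_mul (iP z) (exp (-z) / 2)) (e1 z) measurableSet_Iic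
  have j2 : ∀ z, IntegrableOn (fun y => g (z - y) * f y) (Set.Ioi z) := fun z =>
    IntegrableOn.congr_fun (Integrable.const_mul (iQ z) (exp z / 2)) (e2 z) measurableSet_Ioi
  have hG : ∀ z, ∫ y : ℝ, g (z - y) * f y = exp (-z) / 2 * P z + exp z / 2 * Q z := by
    intro z
    rw [← intervalIntegral.integral_Iic_add_Ioi (j1 z) (j2 z), ← setIntegral_congr_fun measurableSet_Iic (e1 z),
      ← setIntegral_congr_fun measurableSet_Ioi (e2 z), integral_const_mul, integral_const_mul]
  have d1 : ∀ z, HasDerivAt (fun z => exp (-z) / 2 * P z) (- (exp (-z) / 2 * P z) + f z / 2) z := by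
    intro z
    have h := (((hasDerivAt_neg z).exp).div_const 2).mul (dP z)
    refine h.congr_deriv ?_
    have : exp (-z) * exp z = 1 := by rw [← exp_add]; simp
    linear_combination (f z / 2) * this
  have d2 : ∀ z, HasDerivAt (fun z => exp z / 2 * Q z) (exp z / 2 * Q z - f z / 2) z := by
    intro z
    have h := ((Real.hasDerivAt_exp z).div_const 2).mul (dQ z)
    refine h.congr_deriv ?_
    have : exp (-z) * exp z = 1 := by rw [← exp_add]; simp
    linear_combination (-f z / 2) * this
  have b1 : ∀ z, |exp (-z) / 2 * P z| ≤ C / 2 := by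
    intro z
    rw [abs_mul, abs_of_pos (by positivity)]
    have : exp (-z) * exp z = 1 := by rw [← exp_add]; simp
    calc exp (-z) / 2 * |P z| ≤ exp (-z) / 2 * (C * exp z) := by gcongr; exact bP z
      _ = C / 2 := by linear_combination (C / 2) * this
  have b2 : ∀ z, |exp z / 2 * Q z| ≤ C / 2 := by
    intro z
    rw [abs_mul, abs_of_pos (by positivity)]
    have : exp (-z) * exp z = 1 := by rw [← exp_add]; simp
    calc exp z / 2 * |Q z| ≤ exp z / 2 * (C * exp (-z)) := by gcongr; exact bQ z
      _ = C / 2 := by linear_combination (C / 2) * this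
  refine ⟨fun z => -(exp (-z) / 2 * P z) + exp z / 2 * Q z, ?_, ?_, ?_, ?_, ?_⟩
  · intro z
    rw [← integrableOn_univ, ← Set.Iic_union_Ioi (a := z)]
    exact (j1 z).union (j2 z)
  · intro z
    rw [show (fun z => ∫ y : ℝ, g (z - y) * f y) = _ from funext hG]
    refine ((d1 z).add (d2 z)).congr_deriv (by ring)
  · intro z
    rw [hG]
    refine ((d1 z).neg.add (d2 z)).congr_deriv (by ring)
  · intro z
    have h1 := abs_le.1 (b1 z); have h2 := abs_le.1 (b2 z)
    exact abs_le.2 ⟨by linarith, by linarith⟩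
  · intro z
    rw [hG]
    have h1 := abs_le.1 (b1 z); have h2 := abs_le.1 (b2 z)
    exact abs_le.2 ⟨by linarith, by linarith⟩

lemma left_max_deriv (φ : ℝ → ℝ) (c s : ℝ) (hs : 0 < s) (h : HasDerivAt φ c s)
    (hm : ∀ y ∈ Set.Icc 0 s, φ y ≤ φ s) : 0 ≤ c := by
  have h1 := (hasDerivAt_iff_tendsto_slope.1 h).mono_left
    (nhdsWithin_mono s (show Set.Iio s ⊆ {s}ᶜ from fun y hy => ne_of_lt hy))
  refine ge_of_tendsto h1 ?_
  filter_upwards [Ioo_mem_nhdsLT hs] with y hy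
  rw [slope_def_field]
  exact div_nonneg_of_nonpos (by linarith [hm y ⟨hy.1.le, hy.2.le⟩]) (by linarith [hy.2])

lemma max_principle (d : ℝ) (W Wt Wx : ℝ → ℝ → ℝ) (V K lam B : ℝ) (hV : 0 ≤ V)
    (hK : 0 ≤ K)
    (hcont : ∀ R : ℝ, ContinuousOn (fun p : ℝ × ℝ => W p.1 p.2) (Set.Icc 0 d ×ˢ Set.Icc (-R) R))
    (hB : ∀ s ∈ Set.Icc 0 d, ∀ x, W s x ≤ B)
    (ht : ∀ s ∈ Set.Icc 0 d, ∀ x, HasDerivAt (fun r => W r x) (Wt s x) s)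
    (hx : ∀ s ∈ Set.Icc 0 d, ∀ x, HasDerivAt (W s) (Wx s x) x)
    (h0 : ∀ x, W 0 x ≤ 0)
    (hle : ∀ s ∈ Set.Icc 0 d, ∀ x, Wt s x ≤ V * |Wx s x| + K * (lam * exp (lam * s))) :
    ∀ s ∈ Set.Icc 0 d, ∀ x, W s x ≤ K * exp (lam * s) := by
  intro s' hs' x'
  have key : ∀ ε > 0, W s' x' ≤ K * exp (lam * s') + ε * (√(1 + x' ^ 2) + (V + 1) * s') := by
    intro ε hε
    by_contra hcon
    push Not at hcon
    set φ : ℝ → ℝ → ℝ := fun s x => W s x - K * exp (lam * s) - ε * (√(1 + x ^ 2) + (V + 1) * s) with hφ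
    obtain ⟨R, hR1, hR2⟩ : ∃ R, |x'| ≤ R ∧ B < ε * R := by
      refine ⟨max |x'| (B / ε + 1), le_max_left _ _, ?_⟩
      have : B / ε < max |x'| (B / ε + 1) := lt_of_lt_of_le (by linarith) (le_max_right _ _)
      rwa [div_lt_iff₀' hε] at this
    have hc : ContinuousOn (fun p : ℝ × ℝ => φ p.1 p.2) (Set.Icc 0 d ×ˢ Set.Icc (-R) R) := by
      refine ((hcont R).sub ?_).sub ?_
      · fun_prop
      · fun_prop
    obtain ⟨⟨s, x⟩, ⟨hs, hxR⟩, hmax⟩ := (isCompact_Icc.prod isCompact_Icc).exists_isMaxOn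
      ⟨(s', x'), hs', abs_le.1 hR1⟩ hc
    have hpos : 0 < φ s x := by
      have h1 : φ s' x' ≤ φ s x := hmax (show (s', x') ∈ _ from ⟨hs', abs_le.1 hR1⟩)
      have h2 : 0 < φ s' x' := by simp only [hφ]; linarith
      linarith
    simp only at hs hxR
    have hexp : 0 ≤ K * exp (lam * s) := by positivity
    have hxs : |x| ≤ √(1 + x ^ 2) := by
      apply Real.le_sqrt_of_sq_le; rw [sq_abs]; linarith
    have hs0 : 0 < s := by
      rcases hs.1.lt_or_eq with h | h
      · exact h
      · exfalso
        subst h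
        have := h0 x
        have h3 : 0 ≤ ε * (√(1 + x ^ 2) + (V + 1) * 0) := by positivity
        simp only [hφ] at hpos
        linarith
    have hxlt : |x| < R := by
      by_contra hxx
      push Not at hxx
      have h3 := hB s hs x
      have h4 : ε * R ≤ ε * (√(1 + x ^ 2) + (V + 1) * s) := by
        have : 0 ≤ (V + 1) * s := by positivity
        gcongr; linarith
      simp only [hφ] at hpos
      linarith
    have hsq : HasDerivAt (fun x : ℝ => √(1 + x ^ 2)) (x / √(1 + x ^ 2)) x := by
      have h1 : HasDerivAt (fun x : ℝ => 1 + x ^ 2) (2 * x) x := by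
        simpa using (hasDerivAt_pow 2 x).const_add 1
      have h2 := h1.sqrt (by positivity)
      refine h2.congr_deriv ?_
      have : 0 < √(1 + x ^ 2) := by positivity
      field_simp
    have dx : HasDerivAt (φ s) (Wx s x - ε * (x / √(1 + x ^ 2))) x := by
      exact ((hx s hs x).sub_const _).sub ((hsq.add_const _).const_mul ε)
    have dx0 : Wx s x - ε * (x / √(1 + x ^ 2)) = 0 := by
      refine IsLocalMax.hasDerivAt_eq_zero ?_ dx
      filter_upwards [Ioo_mem_nhds (abs_lt.1 hxlt).1 (abs_lt.1 hxlt).2] with y hy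
      exact hmax (show (s, y) ∈ _ from ⟨hs, hy.1.le, hy.2.le⟩)
    have dt : HasDerivAt (fun r => φ r x)
        (Wt s x - K * (exp (lam * s) * (lam * 1)) - ε * ((V + 1) * 1)) s := by
      refine ((ht s hs x).sub ((((hasDerivAt_id' s).const_mul lam).exp).const_mul K)).sub ?_
      exact (((hasDerivAt_id' s).const_mul (V + 1)).const_add _).const_mul ε
    have dt0 := left_max_deriv _ _ s hs0 dt (fun y hy =>
      hmax (show (y, x) ∈ _ from ⟨⟨hy.1, hy.2.trans hs.2⟩, hxR⟩))
    have hWx : |Wx s x| ≤ ε := by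
      rw [show Wx s x = ε * (x / √(1 + x ^ 2)) by linarith, abs_mul, abs_div, abs_of_pos hε,
        abs_of_nonneg (Real.sqrt_nonneg _)]
      have : |x| / √(1 + x ^ 2) ≤ 1 := div_le_one_of_le₀ hxs (Real.sqrt_nonneg _)
      nlinarith
    have h5 := hle s hs x
    have h6 : V * |Wx s x| ≤ V * ε := by gcongr
    nlinarith
  have hlim : Tendsto (fun ε : ℝ => K * exp (lam * s') + ε * (√(1 + x' ^ 2) + (V + 1) * s')) (𝓝[>] 0)
      (𝓝 (K * exp (lam * s'))) := by
    have : Continuous (fun ε : ℝ => K * exp (lam * s') + ε * (√(1 + x' ^ 2) + (V + 1) * s')) := by fun_prop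
    have h := this.tendsto 0
    simp only [zero_mul, add_zero] at h
    exact h.mono_left nhdsWithin_le_nhds
  exact ge_of_tendsto hlim (by filter_upwards [self_mem_nhdsWithin] with ε hε using key ε hε)

lemma timeDomain_mem_nhds {T : ℝ≥0∞} {t : ℝ} (ht : t ∈ timeDomain T) (h0 : 0 < t) :
    timeDomain T ∈ 𝓝 t := by
  have h1 : {s : ℝ | ENNReal.ofReal s < T} ∈ 𝓝 t :=
    (isOpen_lt ENNReal.continuous_ofReal continuous_const).mem_nhds ht.2
  filter_upwards [h1, Ioi_mem_nhds h0] with s hs hs0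
  exact ⟨le_of_lt hs0, hs⟩

lemma timeDomain_of_le {T : ℝ≥0∞} {s t : ℝ} (ht : t ∈ timeDomain T) (h0 : 0 ≤ s) (hst : s ≤ t) :
    s ∈ timeDomain T :=
  ⟨h0, lt_of_le_of_lt (ENNReal.ofReal_le_ofReal hst) ht.2⟩

section sol
variable {n : ℕ} {T : ℝ≥0∞} {u : ℝ → ℝ → ℝ}

lemma hasDeriv_u (hu : IsClassicalSolution n T u) {t : ℝ} (ht : t ∈ timeDomain T) (x : ℝ) :
    HasDerivAt (u t) (ux u t x) x :=
  (((hu.contDiff_x t ht).differentiable (by norm_num)) x).hasDerivAt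

lemma contDiff_ux (hu : IsClassicalSolution n T u) {t : ℝ} (ht : t ∈ timeDomain T) :
    ContDiff ℝ 2 (ux u t) := by
  have h := hu.contDiff_x t ht
  rw [show (3 : WithTop ℕ∞) = 2 + 1 by norm_num, contDiff_succ_iff_deriv] at h
  exact h.2.2

lemma hasDeriv_ux (hu : IsClassicalSolution n T u) {t : ℝ} (ht : t ∈ timeDomain T) (x : ℝ) :
    HasDerivAt (ux u t) (uxx u t x) x :=
  (((contDiff_ux hu ht).differentiable (by norm_num)) x).hasDerivAt

lemma cont_fLoc (hu : IsClassicalSolution n T u) {t : ℝ} (ht : t ∈ timeDomain T) :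
    Continuous (fLoc n u t) := by
  have h1 := (hu.contDiff_x t ht).continuous
  have h2 := (contDiff_ux hu ht).continuous
  unfold fLoc
  fun_prop

lemma box_bound {h : ℝ → ℝ → ℝ} {D : Set ℝ}
    (hc : ContinuousOn (fun p : ℝ × ℝ => h p.1 p.2) (D ×ˢ Set.univ)) (A B : Set ℝ)
    (hA : IsCompact A) (hB : IsCompact B) (hAD : A ⊆ D) :
    ∃ C, ∀ s ∈ A, ∀ x ∈ B, ‖h s x‖ ≤ C := by
  obtain ⟨C, hC⟩ := (hA.prod hB).exists_bound_of_continuousOn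
    (hc.mono (Set.prod_mono hAD (Set.subset_univ B)))
  exact ⟨C, fun s hs x hx => hC (s, x) ⟨hs, hx⟩⟩

lemma joint_cont {h h' : ℝ → ℝ → ℝ} {D : Set ℝ}
    (hc : ContinuousOn (fun p : ℝ × ℝ => h' p.1 p.2) (D ×ˢ Set.univ)) (a b R : ℝ)
    (hAD : Set.Icc a b ⊆ D) (hd : ∀ x, ∀ s ∈ D, HasDerivAt (fun r => h r x) (h' s x) s)
    (hx : ∀ s ∈ D, Continuous (h s)) :
    ContinuousOn (fun p : ℝ × ℝ => h p.1 p.2) (Set.Icc a b ×ˢ Set.Icc (-R) R) := by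
  obtain ⟨C, hC⟩ := box_bound hc _ _ (isCompact_Icc (a := a) (b := b))
    (isCompact_Icc (a := -R) (b := R)) hAD
  refine continuousOn_prod_of_continuousOn_lipschitzOnWith _ C.toNNReal
    (fun s hs => (hx s (hAD hs)).continuousOn) ?_
  intro x hxR
  refine (convex_Icc a b).lipschitzOnWith_of_nnnorm_hasDerivWithin_le
    (fun s hs => (hd x s (hAD hs)).hasDerivWithinAt) ?_
  intro s hs
  rw [← NNReal.coe_le_coe, coe_nnnorm]
  exact (hC s hs x hxR).trans (Real.le_coe_toNNReal C)

lemma hasDeriv_ut (hu : IsClassicalSolution n T u) {t : ℝ} (ht : t ∈ timeDomain T) (h0 : 0 < t)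
    (x : ℝ) : HasDerivAt (ut u t) (utx u t x) x := by
  have hcx : Continuous (utx u t) := by
    rw [← continuousOn_univ]
    exact hu.cont_utx.comp (f := fun y : ℝ => (t, y)) (by fun_prop) (fun y _ => ⟨ht, trivial⟩)
  obtain ⟨δ, hδ, hball⟩ := Metric.nhds_basis_closedBall.mem_iff.1 (timeDomain_mem_nhds ht h0)
  have key : ∀ b, ut u t b = ut u t x + ∫ y in x..b, utx u t y := by
    intro b
    obtain ⟨C, hC⟩ := box_bound hu.cont_utx _ _ (isCompact_closedBall t δ)
      (isCompact_uIcc (a := x) (b := b)) hball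
    have hnh : Metric.closedBall t δ ∈ 𝓝 t := Metric.closedBall_mem_nhds t hδ
    have h1 := (intervalIntegral.hasDerivAt_integral_of_dominated_loc_of_deriv_le
      (F := fun s y => ux u s y) (F' := fun s y => utx u s y) (a := x) (b := b) (μ := volume)
      (bound := fun _ => C) hnh
      (by
        filter_upwards [hnh] with s hs
        exact (contDiff_ux hu (hball hs)).continuous.aestronglyMeasurable)
      ((contDiff_ux hu ht).continuous.intervalIntegrable _ _)
      hcx.aestronglyMeasurable
      (Eventually.of_forall fun y hy s hs => hC s hs y (Set.uIoc_subset_uIcc hy))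
      intervalIntegrable_const
      (Eventually.of_forall fun y hy s hs => (hu.diff_tx y s (hball hs)).hasDerivAt)).2
    have h2 : HasDerivAt (fun s => u s b - u s x) (ut u t b - ut u t x) t :=
      (hu.diff_t b t ht).hasDerivAt.sub (hu.diff_t x t ht).hasDerivAt
    have h3 : (fun s => u s b - u s x) =ᶠ[𝓝 t] fun s => ∫ y in x..b, ux u s y := by
      filter_upwards [hnh] with s hs
      rw [intervalIntegral.integral_eq_sub_of_hasDerivAt
        (fun y _ => hasDeriv_u hu (hball hs) y)
        ((contDiff_ux hu (hball hs)).continuous.intervalIntegrable _ _)]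
    have h4 := h2.unique (h1.congr_of_eventuallyEq h3)
    linarith
  have h5 : HasDerivAt (fun b => ut u t x + ∫ y in x..b, utx u t y) (utx u t x) x :=
    ((hcx.integral_hasStrictDerivAt x x).hasDerivAt).const_add _
  exact h5.congr_of_eventuallyEq (Eventually.of_forall key)

/-- The constant in the bound of `fLoc`. -/
noncomputable def cst (n : ℕ) (M : ℝ) : ℝ :=
  ((n : ℝ) / 2 + (n : ℝ) * ((n : ℝ) + 3) / (2 * ((n : ℝ) + 1))) * M ^ (n - 1)

lemma fLoc_bound (hn : 0 < n) {t M K : ℝ} (hM : ∀ x, |u t x| + |ux u t x| ≤ M)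
    (hK : ∀ x, u t x ^ 2 + ux u t x ^ 2 ≤ K) (x : ℝ) : |fLoc n u t x| ≤ cst n M * K := by
  have hu1 : |u t x| ^ (n - 1) ≤ M ^ (n - 1) := by
    have := hM x
    have := abs_nonneg (ux u t x)
    gcongr
    linarith
  have hM0 : 0 ≤ M ^ (n - 1) := le_trans (by positivity) hu1
  have e : u t x ^ (n + 1) = u t x ^ (n - 1) * u t x ^ 2 := by
    rw [← pow_add]; congr 1; omega
  have b1 : ux u t x ^ 2 ≤ K := by nlinarith [hK x, sq_nonneg (u t x)]
  have b2 : u t x ^ 2 ≤ K := by nlinarith [hK x, sq_nonneg (ux u t x)]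
  have hK0 : 0 ≤ K := le_trans (sq_nonneg _) b1
  unfold fLoc cst
  rw [e]
  refine (abs_add_le _ _).trans ?_
  rw [add_mul, add_mul]
  apply add_le_add
  · rw [abs_mul, abs_mul, abs_pow, abs_of_nonneg (sq_nonneg (ux u t x)), abs_of_nonneg (by positivity)]
    gcongr
  · rw [abs_mul, abs_mul, abs_pow, abs_of_nonneg (sq_nonneg (u t x)), abs_of_nonneg (by positivity),
      ← mul_assoc]
    gcongr

/-- The constant in the differential inequality. -/
noncomputable def cst2 (n : ℕ) (M : ℝ) : ℝ :=
  2 * M * cst n M + 2 * M * ((n : ℝ) * M ^ (n - 1) + 2 * cst n M)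

lemma pointwise (hu : IsClassicalSolution n T u) (hn : 0 < n) {t : ℝ} (ht : t ∈ timeDomain T)
    (h0 : 0 < t) {M K : ℝ} (hM : ∀ x, |u t x| + |ux u t x| ≤ M)
    (hK : ∀ x, u t x ^ 2 + ux u t x ^ 2 ≤ K) (x : ℝ) :
    |2 * u t x * ut u t x + 2 * ux u t x * utx u t x| ≤
      M ^ n * |2 * u t x * ux u t x + 2 * ux u t x * uxx u t x| + cst2 n M * K := by
  have hfb := fLoc_bound hn hM hK
  obtain ⟨H, -, h1, h2, h3, h4⟩ := green_props (fLoc n u t) (cont_fLoc hu ht) _ hfb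
  have hF : ∀ z, FLoc n u t z = H z := fun z => (h1 z).deriv
  have hut : ut u t = fun z => -(u t z ^ n * ux u t z) - H z := by
    funext z
    have := hu.nonlocal t ht z
    rw [hF] at this; linarith
  set G := ∫ y : ℝ, g (x - y) * fLoc n u t y with hG
  have hd : HasDerivAt (ut u t) (-((n : ℝ) * u t x ^ (n - 1) * ux u t x * ux u t x
      + u t x ^ n * uxx u t x) - (G - fLoc n u t x)) x := by
    rw [hut]
    exact ((((hasDeriv_u hu ht x).pow n).mul (hasDeriv_ux hu ht x)).neg).sub (h2 x)
  have hutx := (hasDeriv_ut hu ht h0 x).unique hd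
  have hutv : ut u t x = -(u t x ^ n * ux u t x) - H x := congrFun hut x
  rw [hutx, hutv]
  set a := u t x
  set b := ux u t x
  have ha : |a| ≤ M := by linarith [hM x, abs_nonneg b]
  have hb : |b| ≤ M := by linarith [hM x, abs_nonneg a]
  have hM0 : 0 ≤ M := (abs_nonneg a).trans ha
  have hb2 : b ^ 2 ≤ K := by nlinarith [hK x, sq_nonneg a]
  have e : 2 * a * (-(a ^ n * b) - H x) + 2 * b * (-((n : ℝ) * a ^ (n - 1) * b * b
      + a ^ n * uxx u t x) - (G - fLoc n u t x)) =
      -(a ^ n * (2 * a * b + 2 * b * uxx u t x)) + (-(2 * a * H x)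
        + -(2 * b * ((n : ℝ) * a ^ (n - 1) * b ^ 2 + (G - fLoc n u t x)))) := by ring
  rw [e]
  refine (abs_add_le _ _).trans (add_le_add ?_ ((abs_add_le _ _).trans ?_))
  · rw [abs_neg, abs_mul, abs_pow]; gcongr
  · unfold cst2
    rw [add_mul]
    have hGf : |G - fLoc n u t x| ≤ 2 * (cst n M * K) := by
      have := abs_sub G (fLoc n u t x)
      linarith [h4 x, hfb x]
    apply add_le_add
    · rw [abs_neg, abs_mul, abs_mul, abs_two, mul_assoc (2 * M)]
      gcongr
      exact h3 x
    · rw [abs_neg, abs_mul, abs_mul, abs_two, mul_assoc (2 * M)]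
      gcongr
      refine (abs_add_le _ _).trans ?_
      rw [add_mul, mul_assoc 2]
      refine add_le_add ?_ hGf
      rw [abs_mul, abs_mul, abs_pow, abs_of_nonneg (sq_nonneg b), abs_of_nonneg (Nat.cast_nonneg n)]
      gcongr

lemma cst2_nonneg (n : ℕ) {M : ℝ} (hM : 0 ≤ M) : 0 ≤ cst2 n M := by
  unfold cst2 cst; positivity

lemma slab (hu : IsClassicalSolution n T u) (hn : 0 < n) (τ σ d M : ℝ) (hσ : |σ| = 1)
    (hdom : ∀ s ∈ Set.Icc 0 d, τ + σ * s ∈ timeDomain T ∧ 0 < τ + σ * s)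
    (hM : ∀ s ∈ Set.Icc 0 d, ∀ x, |u (τ + σ * s) x| + |ux u (τ + σ * s) x| ≤ M)
    (hτ : ∀ x, u τ x = 0) :
    ∀ s ∈ Set.Icc 0 d, ∀ x, u (τ + σ * s) x = 0 := by
  intro s₁ hs₁ x₁
  have hM0 : 0 ≤ M := le_trans (by positivity) (hM s₁ hs₁ x₁)
  set W : ℝ → ℝ → ℝ := fun s x => u (τ + σ * s) x ^ 2 + ux u (τ + σ * s) x ^ 2 with hW
  set Wt : ℝ → ℝ → ℝ := fun s x => (2 * u (τ + σ * s) x * ut u (τ + σ * s) x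
    + 2 * ux u (τ + σ * s) x * utx u (τ + σ * s) x) * σ with hWt
  set Wx : ℝ → ℝ → ℝ := fun s x => 2 * u (τ + σ * s) x * ux u (τ + σ * s) x
    + 2 * ux u (τ + σ * s) x * uxx u (τ + σ * s) x with hWx
  set D : Set ℝ := {s | τ + σ * s ∈ timeDomain T} with hD
  have hsub : Set.Icc 0 d ⊆ D := fun s hs => (hdom s hs).1
  have hlin : ∀ s, HasDerivAt (fun s => τ + σ * s) σ s := fun s => by
    simpa using ((hasDerivAt_id' s).const_mul σ).const_add τ
  have du : ∀ x, ∀ s ∈ D, HasDerivAt (fun r => u (τ + σ * r) x) (ut u (τ + σ * s) x * σ) s :=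
    fun x s hs => HasDerivAt.comp s (h₂ := fun r => u r x) (hu.diff_t x _ hs).hasDerivAt (hlin s)
  have dux : ∀ x, ∀ s ∈ D, HasDerivAt (fun r => ux u (τ + σ * r) x) (utx u (τ + σ * s) x * σ) s :=
    fun x s hs => HasDerivAt.comp s (h₂ := fun r => ux u r x) (hu.diff_tx x _ hs).hasDerivAt (hlin s)
  have cut : ContinuousOn (fun p : ℝ × ℝ => ut u (τ + σ * p.1) p.2 * σ) (D ×ˢ Set.univ) := by
    refine ContinuousOn.mul ?_ continuousOn_const
    exact hu.cont_ut.comp (f := fun p : ℝ × ℝ => (τ + σ * p.1, p.2)) (by fun_prop)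
      (fun p hp => ⟨hp.1, trivial⟩)
  have cutx : ContinuousOn (fun p : ℝ × ℝ => utx u (τ + σ * p.1) p.2 * σ) (D ×ˢ Set.univ) := by
    refine ContinuousOn.mul ?_ continuousOn_const
    exact hu.cont_utx.comp (f := fun p : ℝ × ℝ => (τ + σ * p.1, p.2)) (by fun_prop)
      (fun p hp => ⟨hp.1, trivial⟩)
  have hcont : ∀ R : ℝ, ContinuousOn (fun p : ℝ × ℝ => W p.1 p.2)
      (Set.Icc 0 d ×ˢ Set.Icc (-R) R) := by
    intro R
    have c1 := joint_cont (h := fun s x => u (τ + σ * s) x)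
      (h' := fun s x => ut u (τ + σ * s) x * σ) cut 0 d R hsub du
      (fun s hs => (hu.contDiff_x _ hs).continuous)
    have c2 := joint_cont (h := fun s x => ux u (τ + σ * s) x)
      (h' := fun s x => utx u (τ + σ * s) x * σ) cutx 0 d R hsub dux
      (fun s hs => (contDiff_ux hu hs).continuous)
    exact (c1.pow 2).add (c2.pow 2)
  have hB : ∀ s ∈ Set.Icc 0 d, ∀ x, W s x ≤ M ^ 2 := by
    intro s hs x
    have h := hM s hs x
    have h1 := abs_nonneg (u (τ + σ * s) x)
    have h2 := abs_nonneg (ux u (τ + σ * s) x)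
    simp only [hW]
    rw [← sq_abs (u _ x), ← sq_abs (ux u _ x)]
    nlinarith
  have ht : ∀ s ∈ Set.Icc 0 d, ∀ x, HasDerivAt (fun r => W r x) (Wt s x) s := by
    intro s hs x
    refine (((du x s (hsub hs)).pow 2).add ((dux x s (hsub hs)).pow 2)).congr_deriv ?_
    simp only [hWt]; push_cast; ring
  have hx : ∀ s ∈ Set.Icc 0 d, ∀ x, HasDerivAt (W s) (Wx s x) x := by
    intro s hs x
    refine (((hasDeriv_u hu (hsub hs) x).pow 2).add ((hasDeriv_ux hu (hsub hs) x).pow 2)).congr_deriv ?_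
    simp only [hWx]; push_cast; ring
  have h0 : ∀ x, W 0 x ≤ 0 := by
    intro x
    have e : u τ = fun _ => 0 := funext hτ
    simp [hW, ux, e]
  set lam := 2 * cst2 n M with hlam
  have hlam0 : 0 ≤ lam := by have := cst2_nonneg n hM0; positivity
  have iter : ∀ m : ℕ, ∀ s ∈ Set.Icc 0 d, ∀ x, W s x ≤ M ^ 2 * (1 / 2) ^ m * exp (lam * s) := by
    intro m
    induction m with
    | zero =>
      intro s hs x
      have h1 := hB s hs x
      have h2 : 1 ≤ exp (lam * s) := Real.one_le_exp (mul_nonneg hlam0 hs.1)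
      nlinarith [sq_nonneg M]
    | succ m ih =>
      refine max_principle d W Wt Wx (M ^ n) _ lam (M ^ 2) (by positivity) (by positivity)
        hcont hB ht hx h0 ?_
      intro s hs x
      have h1 := pointwise hu hn (hdom s hs).1 (hdom s hs).2 (hM s hs) (ih s hs) x
      have h2 : Wt s x ≤ |2 * u (τ + σ * s) x * ut u (τ + σ * s) x
          + 2 * ux u (τ + σ * s) x * utx u (τ + σ * s) x| := by
        refine (le_abs_self _).trans ?_
        simp only [hWt]
        rw [abs_mul, hσ, mul_one]
      refine h2.trans (h1.trans (le_of_eq ?_))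
      simp only [hWx, hlam]
      ring
  have hlim : Tendsto (fun m : ℕ => M ^ 2 * (1 / 2) ^ m * exp (lam * s₁)) atTop (𝓝 0) := by
    have := ((tendsto_pow_atTop_nhds_zero_of_lt_one (r := (1 / 2 : ℝ)) (by norm_num)
      (by norm_num)).const_mul (M ^ 2)).mul_const (exp (lam * s₁))
    simpa using this
  have hW0 : W s₁ x₁ ≤ 0 := ge_of_tendsto' hlim (fun m => iter m s₁ hs₁ x₁)
  simp only [hW] at hW0
  have : u (τ + σ * s₁) x₁ ^ 2 = 0 := by
    nlinarith [sq_nonneg (u (τ + σ * s₁) x₁), sq_nonneg (ux u (τ + σ * s₁) x₁)]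
  exact pow_eq_zero_iff (two_ne_zero) |>.1 this

lemma zero_at_time (hu : IsClassicalSolution n T u) (hn : 0 < n) (hodd : Odd n) {τ : ℝ}
    (hτ : τ ∈ timeDomain T) {x₀ x₁ : ℝ} (hx : x₀ < x₁)
    (h0 : ∀ x ∈ Set.Ioo x₀ x₁, u τ x = 0) (h1 : ∀ x ∈ Set.Ioo x₀ x₁, ut u τ x = 0) :
    ∀ x, u τ x = 0 := by
  have hux0 : ∀ x ∈ Set.Ioo x₀ x₁, ux u τ x = 0 := by
    intro x hx
    have : u τ =ᶠ[𝓝 x] fun _ => 0 := by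
      filter_upwards [Ioo_mem_nhds hx.1 hx.2] with y hy using h0 y hy
    unfold ux
    rw [this.deriv_eq]; simp
  obtain ⟨M, hM⟩ := hu.sup_bound τ hτ
  have hM := hM τ ⟨hτ.1, le_rfl⟩
  have hK : ∀ x, u τ x ^ 2 + ux u τ x ^ 2 ≤ M ^ 2 := by
    intro x
    have h := hM x
    have h1 := abs_nonneg (u τ x)
    have h2 := abs_nonneg (ux u τ x)
    rw [← sq_abs (u _ x), ← sq_abs (ux u _ x)]
    nlinarith
  obtain ⟨H, i1, d1, d2, -, -⟩ := green_props (fLoc n u τ) (cont_fLoc hu hτ) _ (fLoc_bound hn hM hK)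
  have hH : ∀ x ∈ Set.Ioo x₀ x₁, H x = 0 := by
    intro x hx
    have h2 := hu.nonlocal τ hτ x
    have hF : FLoc n u τ x = H x := (d1 x).deriv
    rw [h1 x hx, h0 x hx, hux0 x hx, hF] at h2
    simpa using h2
  set a := (x₀ + x₁) / 2 with ha
  have haI : a ∈ Set.Ioo x₀ x₁ := ⟨by linarith, by linarith⟩
  have hf0 : fLoc n u τ a = 0 := by
    simp [fLoc, h0 a haI, hux0 a haI]
  have hHe : H =ᶠ[𝓝 a] fun _ => 0 := by
    filter_upwards [Ioo_mem_nhds haI.1 haI.2] with y hy using hH y hy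
  have hG0 : ∫ y : ℝ, g (a - y) * fLoc n u τ y = 0 := by
    have := (d2 a).unique ((hasDerivAt_const a (0:ℝ)).congr_of_eventuallyEq hHe)
    linarith
  have hev1 : Even (n - 1) := Nat.Odd.sub_odd hodd odd_one
  have hev2 : Even (n + 1) := hodd.add_one
  have hnn : ∀ y, 0 ≤ g (a - y) * fLoc n u τ y := by
    intro y
    have := hev1.pow_nonneg (u τ y)
    have := hev2.pow_nonneg (u τ y)
    unfold g fLoc
    positivity
  rw [integral_eq_zero_iff_of_nonneg hnn (i1 a)] at hG0
  have hcg : Continuous (fun y => g (a - y) * fLoc n u τ y) := by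
    have := cont_fLoc hu hτ
    unfold g
    fun_prop
  have hz := (hcg.ae_eq_iff_eq (μ := volume) continuous_const).1 hG0
  intro x
  have h3 : g (a - x) * fLoc n u τ x = 0 := congrFun hz x
  have hg : g (a - x) ≠ 0 := by unfold g; positivity
  have h4 : fLoc n u τ x = 0 := by simpa [hg] using h3
  have q1 := hev1.pow_nonneg (u τ x)
  have q2 := hev2.pow_nonneg (u τ x)
  have hc : 0 < (n : ℝ) * ((n : ℝ) + 3) / (2 * ((n : ℝ) + 1)) := by positivity
  unfold fLoc at h4
  have h5 : 0 ≤ ((n : ℝ) / 2) * u τ x ^ (n - 1) * ux u τ x ^ 2 := by positivity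
  have h6 : u τ x ^ (n + 1) = 0 := by
    rcases q2.lt_or_eq with h | h
    · have := mul_pos hc h
      linarith
    · exact h.symm
  exact pow_eq_zero_iff (by omega) |>.1 h6

end sol

/-- Unique continuation: if `n` is odd and the solution vanishes on a
nonempty open rectangle `(t₀,t₁) × (x₀,x₁) ⊆ [0,T) × ℝ`, then it vanishes identically. -/
theorem unique_continuation_from_rectangle
    (n : ℕ) (hn : 0 < n) (hodd : Odd n) (T : ℝ≥0∞) (hT : 0 < T) (u : ℝ → ℝ → ℝ)
    (hu : IsClassicalSolution n T u)
    (t₀ t₁ x₀ x₁ : ℝ) (ht₀ : 0 ≤ t₀) (ht₀₁ : t₀ < t₁) (ht₁T : ENNReal.ofReal t₁ ≤ T)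
    (hx₀₁ : x₀ < x₁)
    (hvanish : ∀ t ∈ Set.Ioo t₀ t₁, ∀ x ∈ Set.Ioo x₀ x₁, u t x = 0) :
    ∀ t ∈ timeDomain T, ∀ x : ℝ, u t x = 0 := by
  set τ := (t₀ + t₁) / 2 with hτdef
  have hτ1 : t₀ < τ := by linarith
  have hτ2 : τ < t₁ := by linarith
  have hτ0 : 0 < τ := by linarith
  have hτd : τ ∈ timeDomain T := by
    refine ⟨hτ0.le, lt_of_lt_of_le ?_ ht₁T⟩
    exact (ENNReal.ofReal_lt_ofReal_iff (by linarith)).2 hτ2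
  have hτz : ∀ x, u τ x = 0 := by
    refine zero_at_time hu hn hodd hτd hx₀₁ (hvanish τ ⟨hτ1, hτ2⟩) ?_
    intro x hx
    have : (fun s => u s x) =ᶠ[𝓝 τ] fun _ => 0 := by
      filter_upwards [Ioo_mem_nhds hτ1 hτ2] with s hs using hvanish s hs x hx
    unfold ut
    rw [this.deriv_eq]; simp
  have hpos : ∀ t ∈ timeDomain T, 0 < t → ∀ x, u t x = 0 := by
    intro t ht ht0 x
    rcases le_total τ t with h | h
    · obtain ⟨M, hM⟩ := hu.sup_bound t ht
      have := slab hu hn τ 1 (t - τ) M (by simp)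
        (fun s hs => ⟨timeDomain_of_le ht (by linarith [hs.1]) (by linarith [hs.2]),
          by linarith [hs.1]⟩)
        (fun s hs y => hM _ ⟨by linarith [hs.1], by linarith [hs.2]⟩ y) hτz (t - τ)
        ⟨by linarith, le_rfl⟩ x
      rwa [show τ + 1 * (t - τ) = t by ring] at this
    · obtain ⟨M, hM⟩ := hu.sup_bound τ hτd
      have := slab hu hn τ (-1) (τ - t) M (by simp)
        (fun s hs => ⟨timeDomain_of_le hτd (by linarith [hs.2]) (by linarith [hs.1]),
          by linarith [hs.2]⟩)
        (fun s hs y => hM _ ⟨by linarith [hs.2], by linarith [hs.1]⟩ y) hτz (τ - t)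
        ⟨by linarith, le_rfl⟩ x
      rwa [show τ + -1 * (τ - t) = t by ring] at this
  intro t ht x
  rcases ht.1.lt_or_eq with h | h
  · exact hpos t ht h x
  · subst h
    have hc := ((hu.diff_t x 0 ht).continuousAt.tendsto).mono_left
      (nhdsWithin_le_nhds (s := Set.Ioi 0))
    refine tendsto_nhds_unique hc (tendsto_const_nhds.congr' ?_)
    filter_upwards [Ioo_mem_nhdsGT hτ0] with s hs
    exact (hpos s (timeDomain_of_le hτd hs.1.le hs.2.le) hs.1 x).symm
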